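/- arXiv:1009.4297 — 2 statements merged into one kernel-verified Lean document; each statement's English description precedes it below -/
import Mathlib

section
/- Suppose J₁ = J₂ > 0 and N is even. If S is a ground state of H_N on T_N, i.e. H_N(S) = min over all configurations of H_N, then there exist a unit vector ê ∈ ℝ² and a set Λ of sites of T_N whose two coordinates are both even or both odd, such that applying the flips φ_r for all r ∈ Λ to S yields the constant configuration equal to ê at every site. -/
open scoped BigOperators

/-- The `N × N` torus `(ℤ/Nℤ)²`. -/
abbrev Torus (N : ℕ) := ZMod N × ZMod N

/-- A spin configuration assigns a unit vector of `ℝ²` to each site. -/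
def IsConfig {N : ℕ} (S : Torus N → ℝ × ℝ) : Prop :=
  ∀ r, (S r).1 ^ 2 + (S r).2 ^ 2 = 1

/-- The plaquette-orbital Hamiltonian on the torus. -/
noncomputable def ham (N : ℕ) [NeZero N] (J₁ J₂ : ℝ) (S : Torus N → ℝ × ℝ) : ℝ :=
  - J₁ * ((∑ r : Torus N, if Even r.1.val then (S r).1 * (S (r + (1, 0))).1 else 0)
        + (∑ r : Torus N, if Even r.2.val then (S r).1 * (S (r + (0, 1))).1 else 0))
  - J₂ * ((∑ r : Torus N, if ¬ Even r.1.val then (S r).2 * (S (r + (1, 0))).2 else 0)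
        + (∑ r : Torus N, if ¬ Even r.2.val then (S r).2 * (S (r + (0, 1))).2 else 0))

/-- The plaquette flip `φ_r`. -/
def plaqFlip (N : ℕ) [NeZero N] (r : Torus N) (S : Torus N → ℝ × ℝ) :
    Torus N → ℝ × ℝ := fun u =>
  if u = r ∨ u = r + (1, 0) ∨ u = r + (0, 1) ∨ u = r + (1, 1) then
    if Even r.1.val ∧ Even r.2.val then (-(S u).1, (S u).2)
    else if ¬ Even r.1.val ∧ ¬ Even r.2.val then ((S u).1, -(S u).2)
    else S u
  else S u

/-- Application of the (mutually commuting) flips `φ_r` for all `r ∈ Λ`. -/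
noncomputable def plaqFlipSet (N : ℕ) [NeZero N] (Λ : Finset (Torus N)) (S : Torus N → ℝ × ℝ) :
    Torus N → ℝ × ℝ :=
  Λ.toList.foldr (plaqFlip N) S

/-- On a finite abelian group, if translation by `v` exchanges `p` with its complement, then the
edges `{r, r + v}` with `p r` form a perfect matching, and completing the square on each edge
rewrites the correlation sum. -/
lemma sum_matching_eq {G : Type*} [AddCommGroup G] [Fintype G] (p : G → Prop)
    [DecidablePred p] (v : G)
    (hp : ∀ r, p (r + v) ↔ ¬ p r) (f : G → ℝ) :
    (∑ r, if p r then f r * f (r + v) else 0)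
      = (∑ r, f r ^ 2) / 2 - (∑ r, if p r then (f r - f (r + v)) ^ 2 else 0) / 2 := by
  have hshift : (∑ r, if p r then f (r + v) ^ 2 else 0) = ∑ r, if p r then 0 else f r ^ 2 := by
    rw [← Equiv.sum_comp (Equiv.addRight v) (fun r => if p r then 0 else f r ^ 2)]
    refine Finset.sum_congr rfl fun r _ => ?_
    by_cases h : p r <;> simp [hp, h]
  have hsplit : (∑ r, f r ^ 2) = ∑ r, if p r then f r ^ 2 + f (r + v) ^ 2 else 0 := by
    have h1 : (∑ r, if p r then f r ^ 2 + f (r + v) ^ 2 else 0)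
        = (∑ r, if p r then f r ^ 2 else 0) + ∑ r, if p r then f (r + v) ^ 2 else 0 := by
      rw [← Finset.sum_add_distrib]
      exact Finset.sum_congr rfl fun r _ => by split_ifs <;> simp
    rw [h1, hshift, ← Finset.sum_add_distrib]
    exact Finset.sum_congr rfl fun r _ => by split_ifs <;> simp
  rw [hsplit, ← sub_div, ← Finset.sum_sub_distrib, Finset.sum_div]
  refine Finset.sum_congr rfl fun r _ => ?_
  split_ifs <;> ring

lemma even_val_add_one {N : ℕ} [NeZero N] (hN : Even N) (a : ZMod N) :
    Even (a + 1).val ↔ ¬ Even a.val := by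
  have h2 : 2 ∣ N := hN.two_dvd
  have : Fact (1 < N) := ⟨by have := NeZero.pos N; lia⟩
  rw [ZMod.val_add, ZMod.val_one, Nat.even_iff, Nat.mod_mod_of_dvd _ h2, Nat.even_iff]
  lia

open Classical in
/-- The endpoint satisfying `p` of the edge `{b, b + 1}`, `p b`, containing `a`. -/
noncomputable def anchor {N : ℕ} (p : ZMod N → Prop) (a : ZMod N) : ZMod N :=
  if p a then a else a - 1

lemma anchor_spec {N : ℕ} {p : ZMod N → Prop} (hp : ∀ a, p (a + 1) ↔ ¬ p a) (a : ZMod N) :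
    p (anchor p a) := by
  unfold anchor
  split_ifs with h
  · exact h
  · by_contra h'
    exact h (by simpa using (hp (a - 1)).2 h')

lemma eq_or_eq_add_one_iff {N : ℕ} {p : ZMod N → Prop} (hp : ∀ a, p (a + 1) ↔ ¬ p a)
    {b : ZMod N} (hb : p b) (a : ZMod N) : (a = b ∨ a = b + 1) ↔ b = anchor p a := by
  constructor
  · rintro (rfl | rfl)
    · simp [anchor, hb]
    · simp [anchor, hp, hb]
  · rintro rfl
    unfold anchor
    split_ifs <;> simp

lemma apply_anchor {N : ℕ} {α : Type*} {p : ZMod N → Prop} (hp : ∀ a, p (a + 1) ↔ ¬ p a)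
    (f : ZMod N → α) (hf : ∀ a, p a → f a = f (a + 1)) (a : ZMod N) :
    f (anchor p a) = f a := by
  have h := hf _ (anchor_spec hp a)
  rcases (eq_or_eq_add_one_iff hp (anchor_spec hp a) a).2 rfl with h' | h'
  · rw [← h']
  · rw [h, ← h']

/-- The corner, with both coordinates satisfying `p`, of the plaquette containing `u`. -/
noncomputable def corner {N : ℕ} (p : ZMod N → Prop) (u : Torus N) : Torus N :=
  (anchor p u.1, anchor p u.2)

lemma mem_plaquette_iff {N : ℕ} {p : ZMod N → Prop} (hp : ∀ a, p (a + 1) ↔ ¬ p a)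
    {r : Torus N} (h1 : p r.1) (h2 : p r.2) (u : Torus N) :
    (u = r ∨ u = r + (1, 0) ∨ u = r + (0, 1) ∨ u = r + (1, 1)) ↔ r = corner p u := by
  have e1 := eq_or_eq_add_one_iff hp h1 u.1
  have e2 := eq_or_eq_add_one_iff hp h2 u.2
  simp only [corner, Prod.ext_iff, ← e1, ← e2, Prod.fst_add, Prod.snd_add, add_zero]
  tauto

lemma apply_corner {N : ℕ} {α : Type*} {p : ZMod N → Prop} (hp : ∀ a, p (a + 1) ↔ ¬ p a)
    (f : Torus N → α) (h1 : ∀ r : Torus N, p r.1 → f r = f (r + (1, 0)))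
    (h2 : ∀ r : Torus N, p r.2 → f r = f (r + (0, 1))) (u : Torus N) :
    f (corner p u) = f u := by
  have e1 := apply_anchor hp (fun a => f (a, anchor p u.2))
    (fun a ha => by simpa using h1 (a, _) ha) u.1
  have e2 := apply_anchor hp (fun b => f (u.1, b)) (fun b hb => by simpa using h2 (_, b) hb) u.2
  exact e1.trans e2

lemma eq_apply_zero_of_shift_invariant {N : ℕ} [NeZero N] {α : Type*} (f : Torus N → α)
    (h1 : ∀ r, f (r + (1, 0)) = f r) (h2 : ∀ r, f (r + (0, 1)) = f r) (u : Torus N) :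
    f u = f 0 := by
  have a1 : ∀ (n : ℕ) (b : ZMod N), f (n, b) = f (0, b) := by
    intro n b
    induction n with
    | zero => simp
    | succ n ih => simpa [ih] using h1 (n, b)
  have a2 : ∀ n : ℕ, f (0, n) = f (0, 0) := by
    intro n
    induction n with
    | zero => simp
    | succ n ih => simpa [ih] using h2 (0, n)
  obtain ⟨a, b⟩ := u
  rw [← ZMod.natCast_zmod_val a, ← ZMod.natCast_zmod_val b, a1, a2]
  rfl

open Classical in
/-- A product of flips acts on each site by one sign per component, read off at the corners of
the two plaquettes containing the site. -/
lemma foldr_plaqFlip_apply {N : ℕ} [NeZero N] (hN : Even N) (S : Torus N → ℝ × ℝ)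
    (l : List (Torus N)) (hl : l.Nodup)
    (hpar : ∀ r ∈ l, (Even r.1.val ∧ Even r.2.val) ∨ (¬ Even r.1.val ∧ ¬ Even r.2.val))
    (u : Torus N) :
    l.foldr (plaqFlip N) S u =
      (if corner (fun a => Even a.val) u ∈ l then -(S u).1 else (S u).1,
        if corner (fun a => ¬ Even a.val) u ∈ l then -(S u).2 else (S u).2) := by
  have hE := even_val_add_one hN
  have hO : ∀ a : ZMod N, ¬ Even (a + 1).val ↔ ¬ ¬ Even a.val := fun a => not_congr (hE a)
  induction l with
  | nil => simp
  | cons r l ih =>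
    rw [List.nodup_cons] at hl
    have ih := ih hl.2 fun s hs => hpar s (List.mem_cons_of_mem r hs)
    have cE : Even (corner (fun a => Even a.val) u).1.val :=
      anchor_spec (p := fun a => Even a.val) hE u.1
    have cO : ¬ Even (corner (fun a => ¬ Even a.val) u).1.val :=
      anchor_spec (p := fun a => ¬ Even a.val) hO u.1
    rw [List.foldr_cons, plaqFlip, ih]
    rcases hpar r List.mem_cons_self with h | h
    · have hm := mem_plaquette_iff (p := fun a => Even a.val) hE h.1 h.2 u
      have hne : corner (fun a => ¬ Even a.val) u ≠ r := fun h' => cO (h' ▸ h.1)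
      simp only [hm, h, List.mem_cons, hne, false_or, and_self, if_true]
      by_cases hr : r = corner (fun a => Even a.val) u
      · have hnot := hr ▸ hl.1
        simp [hr, hnot, -Nat.not_even_iff_odd]
      · simp [hr, Ne.symm hr, -Nat.not_even_iff_odd]
    · have hm := mem_plaquette_iff (p := fun a => ¬ Even a.val) hO h.1 h.2 u
      have hne : corner (fun a => Even a.val) u ≠ r := fun h' => h.1 (h' ▸ cE)
      simp only [hm, h, List.mem_cons, hne, false_or, and_self, if_true, if_false,
        not_false_eq_true]
      by_cases hr : r = corner (fun a => ¬ Even a.val) u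
      · have hnot := hr ▸ hl.1
        simp [hr, hnot, -Nat.not_even_iff_odd]
      · simp [hr, Ne.symm hr, -Nat.not_even_iff_odd]

/-- The ground-state energy is `-J` per site, and the excess energy is a sum of squares over
the edges. -/
lemma ham_eq_sum_sq {N : ℕ} [NeZero N] (hN : Even N) (J : ℝ) (S : Torus N → ℝ × ℝ)
    (hS : IsConfig S) :
    ham N J J S = -J * Fintype.card (Torus N) + J / 2 *
      ((∑ r : Torus N, if Even r.1.val then ((S r).1 - (S (r + (1, 0))).1) ^ 2 else 0)
      + (∑ r : Torus N, if Even r.2.val then ((S r).1 - (S (r + (0, 1))).1) ^ 2 else 0)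
      + (∑ r : Torus N, if ¬ Even r.1.val then ((S r).2 - (S (r + (1, 0))).2) ^ 2 else 0)
      + (∑ r : Torus N, if ¬ Even r.2.val then ((S r).2 - (S (r + (0, 1))).2) ^ 2 else 0)) := by
  have hE := even_val_add_one hN
  have hcard : (∑ r, (S r).1 ^ 2) + ∑ r, (S r).2 ^ 2 = Fintype.card (Torus N) := by
    rw [← Finset.sum_add_distrib, Finset.sum_congr rfl fun r _ => hS r]
    simp
  have k1 := sum_matching_eq (fun r : Torus N => Even r.1.val) (1, 0)
    (fun r => by simpa using hE r.1) (fun r => (S r).1)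
  have k2 := sum_matching_eq (fun r : Torus N => Even r.2.val) (0, 1)
    (fun r => by simpa using hE r.2) (fun r => (S r).1)
  have k3 := sum_matching_eq (fun r : Torus N => ¬ Even r.1.val) (1, 0)
    (fun r => not_congr (by simpa using hE r.1)) (fun r => (S r).2)
  have k4 := sum_matching_eq (fun r : Torus N => ¬ Even r.2.val) (0, 1)
    (fun r => not_congr (by simpa using hE r.2)) (fun r => (S r).2)
  rw [ham, ← hcard]
  linear_combination (-J) * (k1 + k2 + k3 + k4)

/-- In a ground state, the relevant spin components agree along every edge. -/
lemma edge_eq_of_ground_state {N : ℕ} [NeZero N] (hN : Even N) {J : ℝ} (hJ : 0 < J)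
    {S : Torus N → ℝ × ℝ} (hS : IsConfig S)
    (hground : ∀ S' : Torus N → ℝ × ℝ, IsConfig S' → ham N J J S ≤ ham N J J S') :
    (∀ r : Torus N, Even r.1.val → (S r).1 = (S (r + (1, 0))).1) ∧
    (∀ r : Torus N, Even r.2.val → (S r).1 = (S (r + (0, 1))).1) ∧
    (∀ r : Torus N, ¬ Even r.1.val → (S r).2 = (S (r + (1, 0))).2) ∧
    (∀ r : Torus N, ¬ Even r.2.val → (S r).2 = (S (r + (0, 1))).2) := by
  have hconst : IsConfig (fun _ : Torus N => ((1, 0) : ℝ × ℝ)) := fun _ => by norm_num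
  have hle := hground _ hconst
  rw [ham_eq_sum_sq hN J S hS, ham_eq_sum_sq hN J _ hconst] at hle
  simp only [sub_self, ne_eq, OfNat.ofNat_ne_zero, not_false_eq_true, zero_pow, ite_self,
    Finset.sum_const_zero, add_zero, mul_zero] at hle
  have hnn : ∀ (p : Torus N → Prop) [DecidablePred p] (g : Torus N → ℝ),
      0 ≤ ∑ r, if p r then g r ^ 2 else 0 := fun p _ g =>
    Finset.sum_nonneg fun r _ => by split_ifs <;> positivity
  have hzero : ∀ (p : Torus N → Prop) [DecidablePred p] (f g : Torus N → ℝ),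
      (∑ r, if p r then (f r - g r) ^ 2 else 0) ≤ 0 → ∀ r, p r → f r = g r := by
    intro p _ f g h r hr
    have h0 := (Finset.sum_eq_zero_iff_of_nonneg fun r _ => by split_ifs <;> positivity).1
      (le_antisymm h (hnn p fun r => f r - g r)) r (Finset.mem_univ r)
    rw [if_pos hr] at h0
    exact sub_eq_zero.1 (pow_eq_zero_iff two_ne_zero |>.1 h0)
  have n1 := hnn (fun r => Even r.1.val) fun r => (S r).1 - (S (r + (1, 0))).1
  have n2 := hnn (fun r => Even r.2.val) fun r => (S r).1 - (S (r + (0, 1))).1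
  have n3 := hnn (fun r => ¬ Even r.1.val) fun r => (S r).2 - (S (r + (1, 0))).2
  have n4 := hnn (fun r => ¬ Even r.2.val) fun r => (S r).2 - (S (r + (0, 1))).2
  have hsum := nonpos_of_mul_nonpos_right ((add_le_iff_nonpos_right _).1 hle) (half_pos hJ)
  exact ⟨hzero (fun r => Even r.1.val) _ _ (by linarith),
    hzero (fun r => Even r.2.val) _ _ (by linarith),
    hzero (fun r => ¬ Even r.1.val) _ _ (by linarith),
    hzero (fun r => ¬ Even r.2.val) _ _ (by linarith)⟩

/-- Every ground state at the symmetric point `J₁ = J₂ > 0` is carried by plaquette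
flips on a set of equal-parity sites to a constant configuration `S_r ≡ ê` for a
unit vector `ê`. -/
theorem ground_state_structure (N : ℕ) [NeZero N] (hN : Even N) (J : ℝ) (hJ : 0 < J)
    (S : Torus N → ℝ × ℝ) (hS : IsConfig S)
    (hground : ∀ S' : Torus N → ℝ × ℝ, IsConfig S' → ham N J J S ≤ ham N J J S') :
    ∃ e : ℝ × ℝ, e.1 ^ 2 + e.2 ^ 2 = 1 ∧
      ∃ Λ : Finset (Torus N),
        (∀ r ∈ Λ, (Even r.1.val ∧ Even r.2.val) ∨ (¬ Even r.1.val ∧ ¬ Even r.2.val)) ∧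
        ∀ u : Torus N, plaqFlipSet N Λ S u = e := by
  classical
  obtain ⟨x1, x2, z1, z2⟩ := edge_eq_of_ground_state hN hJ hS hground
  have hE := even_val_add_one hN
  have hO : ∀ a : ZMod N, ¬ Even (a + 1).val ↔ ¬ ¬ Even a.val := fun a => not_congr (hE a)
  have sq1 : ∀ r, (S (r + (1, 0))).1 ^ 2 = (S r).1 ^ 2 := fun r => by
    by_cases h : Even r.1.val
    · rw [x1 r h]
    · linear_combination hS (r + (1, 0)) - hS r + ((S r).2 + (S (r + (1, 0))).2) * z1 r h
  have sq2 : ∀ r, (S (r + (0, 1))).1 ^ 2 = (S r).1 ^ 2 := fun r => by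
    by_cases h : Even r.2.val
    · rw [x2 r h]
    · linear_combination hS (r + (0, 1)) - hS r + ((S r).2 + (S (r + (0, 1))).2) * z2 r h
  have hx : ∀ u, (S u).1 ^ 2 = (S 0).1 ^ 2 :=
    eq_apply_zero_of_shift_invariant (fun r => (S r).1 ^ 2) sq1 sq2
  have hz : ∀ u, (S u).2 ^ 2 = (S 0).2 ^ 2 := fun u => by
    linear_combination hS u - hS 0 - hx u
  let Λ : Finset (Torus N) := Finset.univ.filter fun r =>
    (Even r.1.val ∧ Even r.2.val) ∧ (S r).1 < 0 ∨ (¬ Even r.1.val ∧ ¬ Even r.2.val) ∧ (S r).2 < 0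
  have hΛ : ∀ r ∈ Λ, (Even r.1.val ∧ Even r.2.val) ∨ (¬ Even r.1.val ∧ ¬ Even r.2.val) :=
    fun r hr => (Finset.mem_filter.1 hr).2.imp And.left And.left
  refine ⟨(|(S 0).1|, |(S 0).2|), by simpa using hS 0, Λ, hΛ, fun u => ?_⟩
  rw [plaqFlipSet, foldr_plaqFlip_apply hN S _ Λ.nodup_toList (by simpa using hΛ)]
  have cE1 := anchor_spec (p := fun a : ZMod N => Even a.val) hE u.1
  have cE2 := anchor_spec (p := fun a : ZMod N => Even a.val) hE u.2
  have cO1 := anchor_spec (p := fun a : ZMod N => ¬ Even a.val) hO u.1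
  have cO2 := anchor_spec (p := fun a : ZMod N => ¬ Even a.val) hO u.2
  have mE : corner (fun a => Even a.val) u ∈ Λ ↔ (S u).1 < 0 := by
    rw [← apply_corner (p := fun a => Even a.val) hE (fun r => (S r).1) x1 x2 u]
    simp only [Λ, Finset.mem_filter, Finset.mem_univ, true_and]
    exact ⟨fun h => h.elim And.right fun h => absurd cE1 h.1.1, fun h => Or.inl ⟨⟨cE1, cE2⟩, h⟩⟩
  have mO : corner (fun a => ¬ Even a.val) u ∈ Λ ↔ (S u).2 < 0 := by
    rw [← apply_corner (p := fun a => ¬ Even a.val) hO (fun r => (S r).2) z1 z2 u]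
    simp only [Λ, Finset.mem_filter, Finset.mem_univ, true_and]
    exact ⟨fun h => h.elim (fun h => absurd h.1.1 cO1) And.right, fun h => Or.inr ⟨⟨cO1, cO2⟩, h⟩⟩
  have habs : ∀ t : ℝ, (if t < 0 then -t else t) = |t| := fun t => by
    split_ifs with h
    · exact (abs_of_neg h).symm
    · exact (abs_of_nonneg (not_lt.1 h)).symm
  simp only [Finset.mem_toList, mE, mO, habs, (sq_eq_sq_iff_abs_eq_abs _ _).1 (hx u),
    (sq_eq_sq_iff_abs_eq_abs _ _).1 (hz u)]
end

section
/- For all J₁, J₂ ≥ 0, all β ≥ 0, and every even N, the torus Gibbs measure μ_{N,β} is invariant under each plaquette flip φ_r (r ∈ T_N with both coordinates even or both odd), and consequently the expected magnetization vanishes: E_{μ_{N,β}}(S_r^x) = 0 and E_{μ_{N,β}}(S_r^z) = 0 for every site r ∈ T_N. -/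
open scoped BigOperators
open MeasureTheory

instance : Fact (0 < 2 * Real.pi) := ⟨by positivity⟩

noncomputable instance : MeasureSpace Real.Angle :=
  inferInstanceAs (MeasureSpace (AddCircle (2 * Real.pi)))

/-- Configurations of unit spins parametrized by their angles. -/
abbrev Cfg (N : ℕ) := Torus N → Real.Angle

/-- The unit spin `(S^x, S^z)` with angle `φ`. -/
noncomputable def spinOf (φ : Real.Angle) : ℝ × ℝ := (φ.cos, φ.sin)

/-- The Hamiltonian as a function of the angles. -/
noncomputable def hamA (N : ℕ) [NeZero N] (J₁ J₂ : ℝ) (φ : Cfg N) : ℝ :=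
  ham N J₁ J₂ fun r => spinOf (φ r)

/-- The a priori product measure: each site carries the uniform measure on the
circle normalized to total mass `√(2π)`. -/
noncomputable def apriori (N : ℕ) [NeZero N] : Measure (Cfg N) :=
  (ENNReal.ofReal (Real.sqrt (2 * Real.pi) / (2 * Real.pi))) ^ (N ^ 2) •
    Measure.pi (fun _ : Torus N => (volume : Measure Real.Angle))

/-- The partition function `Z_{N,β}`. -/
noncomputable def Zfull (N : ℕ) [NeZero N] (β J₁ J₂ : ℝ) : ℝ :=
  ∫ φ, Real.exp (-β * hamA N J₁ J₂ φ) ∂(apriori N)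

/-- The torus Gibbs measure `μ_{N,β}`, with density proportional to `e^{−βH_N}`
with respect to the a priori measure. -/
noncomputable def gibbs (N : ℕ) [NeZero N] (β J₁ J₂ : ℝ) : Measure (Cfg N) :=
  (ENNReal.ofReal (Zfull N β J₁ J₂))⁻¹ •
    (apriori N).withDensity fun φ => ENNReal.ofReal (Real.exp (-β * hamA N J₁ J₂ φ))

/-- The plaquette flip `φ_r` acting on angles: negating the `x`-component is
`θ ↦ π − θ`, negating the `z`-component is `θ ↦ −θ`. -/
noncomputable def plaqFlipA (N : ℕ) [NeZero N] (r : Torus N) (φ : Cfg N) : Cfg N := fun u =>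
  if u = r ∨ u = r + (1, 0) ∨ u = r + (0, 1) ∨ u = r + (1, 1) then
    if Even r.1.val ∧ Even r.2.val then (Real.pi : Real.Angle) - φ u
    else if ¬ Even r.1.val ∧ ¬ Even r.2.val then - φ u
    else φ u
  else φ u

instance : BorelSpace Real.Angle :=
  inferInstanceAs (BorelSpace (AddCircle (2 * Real.pi)))

instance : SecondCountableTopology Real.Angle :=
  inferInstanceAs (SecondCountableTopology (AddCircle (2 * Real.pi)))

instance : IsFiniteMeasure (volume : Measure Real.Angle) :=
  inferInstanceAs (IsFiniteMeasure (volume : Measure (AddCircle (2 * Real.pi))))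

instance : (volume : Measure Real.Angle).IsAddLeftInvariant :=
  inferInstanceAs (volume : Measure (AddCircle (2 * Real.pi))).IsAddLeftInvariant

instance : (volume : Measure Real.Angle).IsNegInvariant :=
  inferInstanceAs (volume : Measure (AddCircle (2 * Real.pi))).IsNegInvariant

section Parity

variable {N : ℕ} [NeZero N]

theorem ZMod.even_val_add_one_iff (hN : Even N) (x : ZMod N) :
    Even (x + 1).val ↔ ¬ Even x.val := by
  have h2 : 1 < N := by
    have := NeZero.ne N
    obtain ⟨k, rfl⟩ := hN
    omega
  have : Fact (1 < N) := ⟨h2⟩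
  rw [ZMod.val_add, ZMod.val_one, Nat.even_iff,
    Nat.mod_mod_of_dvd _ hN.two_dvd, ← Nat.even_iff, Nat.even_add_one]

theorem ZMod.add_one_mem_pair_iff (hN : Even N) {x a : ZMod N}
    (h : Even x.val ↔ Even a.val) :
    (x + 1 = a ∨ x + 1 = a + 1) ↔ (x = a ∨ x = a + 1) := by
  have h₁ : x + 1 ≠ a := by
    rintro rfl
    rw [ZMod.even_val_add_one_iff hN] at h
    tauto
  have h₂ : x ≠ a + 1 := by
    rintro rfl
    rw [ZMod.even_val_add_one_iff hN] at h
    tauto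
  simp [h₁, h₂]

/-- Every residue lies in a pair `{a, a + 1}` with `a` of prescribed parity. -/
theorem ZMod.exists_even_val_iff_and_mem_pair (hN : Even N) (x : ZMod N) (p : Prop) :
    ∃ a : ZMod N, (Even a.val ↔ p) ∧ (x = a ∨ x = a + 1) := by
  by_cases h : Even x.val ↔ p
  · exact ⟨x, h, Or.inl rfl⟩
  · refine ⟨x - 1, ?_, Or.inr (by simp)⟩
    have := ZMod.even_val_add_one_iff hN (x - 1)
    rw [sub_add_cancel] at this
    tauto

end Parity

section Plaquette

variable {N : ℕ}

/-- The four sites of the plaquette with lower-left corner `r`. -/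
def plaquette (r : Torus N) : Set (Torus N) :=
  {u | u = r ∨ u = r + (1, 0) ∨ u = r + (0, 1) ∨ u = r + (1, 1)}

theorem mem_plaquette_iff_s5 {r u : Torus N} :
    u ∈ plaquette r ↔ (u.1 = r.1 ∨ u.1 = r.1 + 1) ∧ (u.2 = r.2 ∨ u.2 = r.2 + 1) := by
  simp only [plaquette, Set.mem_ofPred_eq, Prod.ext_iff, Prod.fst_add, Prod.snd_add, add_zero]
  tauto

variable [NeZero N]

theorem add_horizontal_mem_plaquette_iff (hN : Even N) {r u : Torus N}
    (h : Even u.1.val ↔ Even r.1.val) : u + (1, 0) ∈ plaquette r ↔ u ∈ plaquette r := by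
  simp only [mem_plaquette_iff_s5, Prod.fst_add, Prod.snd_add, add_zero,
    ZMod.add_one_mem_pair_iff hN h]

theorem add_vertical_mem_plaquette_iff (hN : Even N) {r u : Torus N}
    (h : Even u.2.val ↔ Even r.2.val) : u + (0, 1) ∈ plaquette r ↔ u ∈ plaquette r := by
  simp only [mem_plaquette_iff_s5, Prod.fst_add, Prod.snd_add, add_zero,
    ZMod.add_one_mem_pair_iff hN h]

end Plaquette

section Flip

variable {N : ℕ} [NeZero N] {r : Torus N}

open Classical in
theorem plaqFlipA_of_even (h₁ : Even r.1.val) (h₂ : Even r.2.val) (φ : Cfg N) (u : Torus N) :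
    plaqFlipA N r φ u = if u ∈ plaquette r then (Real.pi : Real.Angle) - φ u else φ u := by
  unfold plaqFlipA plaquette
  simp only [h₁, h₂, and_self, if_true, Set.mem_ofPred_eq]
  congr

open Classical in
theorem plaqFlipA_of_odd (h₁ : ¬ Even r.1.val) (h₂ : ¬ Even r.2.val) (φ : Cfg N) (u : Torus N) :
    plaqFlipA N r φ u = if u ∈ plaquette r then - φ u else φ u := by
  unfold plaqFlipA plaquette
  simp only [h₁, h₂, not_false_eq_true, and_self, if_true, if_false, Set.mem_ofPred_eq]
  congr

theorem Real.Angle.cos_pi_sub (θ : Real.Angle) : ((Real.pi : Real.Angle) - θ).cos = -θ.cos := by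
  rw [← neg_sub, Real.Angle.cos_neg, Real.Angle.cos_sub_pi]

theorem Real.Angle.sin_pi_sub (θ : Real.Angle) : ((Real.pi : Real.Angle) - θ).sin = θ.sin := by
  rw [← neg_sub, Real.Angle.sin_neg, Real.Angle.sin_sub_pi, neg_neg]

theorem hamA_plaqFlipA_of_even (hN : Even N) (J₁ J₂ : ℝ) (h₁ : Even r.1.val)
    (h₂ : Even r.2.val) (φ : Cfg N) : hamA N J₁ J₂ (plaqFlipA N r φ) = hamA N J₁ J₂ φ := by
  have hsin (u : Torus N) : (plaqFlipA N r φ u).sin = (φ u).sin := by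
    rw [plaqFlipA_of_even h₁ h₂]
    split_ifs <;> simp [Real.Angle.sin_pi_sub]
  have hcos {u v : Torus N} (h : v ∈ plaquette r ↔ u ∈ plaquette r) :
      (plaqFlipA N r φ u).cos * (plaqFlipA N r φ v).cos = (φ u).cos * (φ v).cos := by
    rw [plaqFlipA_of_even h₁ h₂, plaqFlipA_of_even h₁ h₂]
    by_cases hu : u ∈ plaquette r <;> simp [h, hu, Real.Angle.cos_pi_sub]
  simp only [hamA, ham, spinOf, hsin]
  congr 2
  congr 1
  · refine Finset.sum_congr rfl fun u _ => ?_
    split_ifs with hu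
    · exact hcos (add_horizontal_mem_plaquette_iff hN (iff_of_true hu h₁))
    · rfl
  · refine Finset.sum_congr rfl fun u _ => ?_
    split_ifs with hu
    · exact hcos (add_vertical_mem_plaquette_iff hN (iff_of_true hu h₂))
    · rfl

theorem hamA_plaqFlipA_of_odd (hN : Even N) (J₁ J₂ : ℝ) (h₁ : ¬ Even r.1.val)
    (h₂ : ¬ Even r.2.val) (φ : Cfg N) : hamA N J₁ J₂ (plaqFlipA N r φ) = hamA N J₁ J₂ φ := by
  have hcos (u : Torus N) : (plaqFlipA N r φ u).cos = (φ u).cos := by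
    rw [plaqFlipA_of_odd h₁ h₂]
    split_ifs <;> simp
  have hsin {u v : Torus N} (h : v ∈ plaquette r ↔ u ∈ plaquette r) :
      (plaqFlipA N r φ u).sin * (plaqFlipA N r φ v).sin = (φ u).sin * (φ v).sin := by
    rw [plaqFlipA_of_odd h₁ h₂, plaqFlipA_of_odd h₁ h₂]
    by_cases hu : u ∈ plaquette r <;> simp [h, hu]
  simp only [hamA, ham, spinOf, hcos]
  congr 2
  congr 1
  · refine Finset.sum_congr rfl fun u _ => ?_
    split_ifs with hu
    · rfl
    · exact hsin (add_horizontal_mem_plaquette_iff hN (iff_of_false hu h₁))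
  · refine Finset.sum_congr rfl fun u _ => ?_
    split_ifs with hu
    · rfl
    · exact hsin (add_vertical_mem_plaquette_iff hN (iff_of_false hu h₂))

theorem hamA_plaqFlipA (hN : Even N) (J₁ J₂ : ℝ)
    (hr : (Even r.1.val ∧ Even r.2.val) ∨ (¬ Even r.1.val ∧ ¬ Even r.2.val)) (φ : Cfg N) :
    hamA N J₁ J₂ (plaqFlipA N r φ) = hamA N J₁ J₂ φ :=
  hr.elim (fun h => hamA_plaqFlipA_of_even hN J₁ J₂ h.1 h.2 φ)
    fun h => hamA_plaqFlipA_of_odd hN J₁ J₂ h.1 h.2 φ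

end Flip

section Measure

variable {N : ℕ} [NeZero N]

theorem measurable_hamA (J₁ J₂ : ℝ) : Measurable (hamA N J₁ J₂) := by
  have hc : Measurable Real.Angle.cos := Real.Angle.continuous_cos.measurable
  have hs : Measurable Real.Angle.sin := Real.Angle.continuous_sin.measurable
  have hcos (u : Torus N) : Measurable fun φ : Cfg N => (φ u).cos :=
    hc.comp (measurable_pi_apply u)
  have hsin (u : Torus N) : Measurable fun φ : Cfg N => (φ u).sin :=
    hs.comp (measurable_pi_apply u)
  have hsum (p : Torus N → Prop) [DecidablePred p] {f : Torus N → Cfg N → ℝ}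
      (hf : ∀ u, Measurable (f u)) : Measurable fun φ => ∑ u, if p u then f u φ else 0 := by
    refine Finset.measurable_fun_sum _ fun u _ => ?_
    split_ifs
    exacts [hf u, measurable_const]
  unfold hamA ham spinOf
  exact (((hsum _ fun u => (hcos u).mul (hcos _)).add
    (hsum _ fun u => (hcos u).mul (hcos _))).const_mul _).sub
    (((hsum _ fun u => (hsin u).mul (hsin _)).add
    (hsum _ fun u => (hsin u).mul (hsin _))).const_mul _)

theorem measurePreserving_plaqFlipA_apriori (r : Torus N) :
    MeasurePreserving (plaqFlipA N r) (apriori N) (apriori N) := by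
  refine MeasurePreserving.smul_measure ?_ _
  unfold plaqFlipA
  refine measurePreserving_pi (fun _ : Torus N => (volume : Measure Real.Angle)) (fun _ => volume)
    (f := fun u θ => if u = r ∨ u = r + (1, 0) ∨ u = r + (0, 1) ∨ u = r + (1, 1) then
      if Even r.1.val ∧ Even r.2.val then (Real.pi : Real.Angle) - θ
      else if ¬ Even r.1.val ∧ ¬ Even r.2.val then - θ
      else θ
    else θ) fun u => ?_
  split_ifs
  exacts [Measure.measurePreserving_sub_left _ _, Measure.measurePreserving_neg _, .id _, .id _]

theorem MeasureTheory.MeasurePreserving.withDensity {α : Type*} [MeasurableSpace α]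
    {μ : Measure α} {T : α → α} (hT : MeasurePreserving T μ μ) {f : α → ENNReal}
    (hf : Measurable f) (hfT : ∀ x, f (T x) = f x) :
    MeasurePreserving T (μ.withDensity f) (μ.withDensity f) := by
  refine ⟨hT.measurable, Measure.ext fun s hs => ?_⟩
  rw [Measure.map_apply hT.measurable hs, withDensity_apply _ hs,
    withDensity_apply _ (hT.measurable hs), ← hT.setLIntegral_comp_preimage hs hf]
  simp only [hfT]

theorem measurePreserving_plaqFlipA_gibbs (hN : Even N) (β J₁ J₂ : ℝ) {r : Torus N}
    (hr : (Even r.1.val ∧ Even r.2.val) ∨ (¬ Even r.1.val ∧ ¬ Even r.2.val)) :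
    MeasurePreserving (plaqFlipA N r) (gibbs N β J₁ J₂) (gibbs N β J₁ J₂) := by
  refine MeasurePreserving.smul_measure ?_ _
  refine (measurePreserving_plaqFlipA_apriori r).withDensity ?_ fun φ => ?_
  · exact ((measurable_hamA J₁ J₂).const_mul (-β)).exp.ennreal_ofReal
  · rw [hamA_plaqFlipA hN J₁ J₂ hr]

theorem MeasureTheory.MeasurePreserving.integral_eq_zero_of_comp_eq_neg {α : Type*}
    [MeasurableSpace α] {μ : Measure α} {T : α → α} (hT : MeasurePreserving T μ μ) {g : α → ℝ}
    (hg : Measurable g) (hgT : ∀ x, g (T x) = - g x) : ∫ x, g x ∂μ = 0 := by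
  have h : ∫ x, g (T x) ∂μ = ∫ x, g x ∂μ := by
    rw [← integral_map hT.measurable.aemeasurable hg.aestronglyMeasurable, hT.map_eq]
  simp only [hgT, integral_neg] at h
  linarith

end Measure

/-- The Gibbs measure is invariant under each plaquette flip, and consequently
the expected magnetization vanishes at every site. -/
theorem gibbs_flip_invariant_and_no_magnetization (N : ℕ) [NeZero N] (hN : Even N)
    (J₁ J₂ β : ℝ) (hJ₁ : 0 ≤ J₁) (hJ₂ : 0 ≤ J₂) (hβ : 0 ≤ β) :
    (∀ r : Torus N, (Even r.1.val ∧ Even r.2.val) ∨ (¬ Even r.1.val ∧ ¬ Even r.2.val) →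
      Measure.map (plaqFlipA N r) (gibbs N β J₁ J₂) = gibbs N β J₁ J₂) ∧
    (∀ r : Torus N,
      (∫ φ, Real.Angle.cos (φ r) ∂(gibbs N β J₁ J₂)) = 0 ∧
      (∫ φ, Real.Angle.sin (φ r) ∂(gibbs N β J₁ J₂)) = 0) := by
  refine ⟨fun r hr => (measurePreserving_plaqFlipA_gibbs hN β J₁ J₂ hr).map_eq, fun r => ⟨?_, ?_⟩⟩
  · obtain ⟨a, ha, hra⟩ := ZMod.exists_even_val_iff_and_mem_pair hN r.1 True
    obtain ⟨b, hb, hrb⟩ := ZMod.exists_even_val_iff_and_mem_pair hN r.2 True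
    rw [iff_true] at ha hb
    refine (measurePreserving_plaqFlipA_gibbs (r := (a, b)) hN β J₁ J₂
      (Or.inl ⟨ha, hb⟩)).integral_eq_zero_of_comp_eq_neg
      (Real.Angle.continuous_cos.measurable.comp (measurable_pi_apply r)) fun φ => ?_
    rw [plaqFlipA_of_even ha hb, if_pos (mem_plaquette_iff_s5.2 ⟨hra, hrb⟩),
      Real.Angle.cos_pi_sub]
  · obtain ⟨a, ha, hra⟩ := ZMod.exists_even_val_iff_and_mem_pair hN r.1 False
    obtain ⟨b, hb, hrb⟩ := ZMod.exists_even_val_iff_and_mem_pair hN r.2 False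
    rw [iff_false] at ha hb
    refine (measurePreserving_plaqFlipA_gibbs (r := (a, b)) hN β J₁ J₂
      (Or.inr ⟨ha, hb⟩)).integral_eq_zero_of_comp_eq_neg
      (Real.Angle.continuous_sin.measurable.comp (measurable_pi_apply r)) fun φ => ?_
    rw [plaqFlipA_of_odd ha hb, if_pos (mem_plaquette_iff_s5.2 ⟨hra, hrb⟩), Real.Angle.sin_neg]
end
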